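/- Let ρ be a d×d density matrix (Hermitian, positive semidefinite, trace 1) over ℂ, let L_1,…,L_m be d×d complex matrices, let D(ρ) = Σ_j (L_j ρ L_j† − ½(L_j†L_j ρ + ρ L_j†L_j)) be the associated Lindblad dissipator, and let γ > 0. Then there exists a Hermitian d×d matrix H with −i(Hρ − ρH) + γ D(ρ) = 0 if and only if for every λ ∈ ℂ and all vectors v, w ∈ ℂ^d with ρv = λv and ρw = λw one has v† D(ρ) w = 0 (i.e., D(ρ) vanishes on every eigenspace of ρ). -/

import Mathlib

open Matrix
open scoped ComplexOrder

namespace Matrix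

variable {n : Type*} [Fintype n]

/-- Every eigenvalue of a complex Hermitian matrix is real. -/
theorem IsHermitian.star_eq_of_mulVec_eq_smul {A : Matrix n n ℂ} (hA : A.IsHermitian)
    {lam : ℂ} {v : n → ℂ} (hv : A *ᵥ v = lam • v) (hv0 : v ≠ 0) : star lam = lam := by
  have h : star (A *ᵥ v) ⬝ᵥ v = star v ⬝ᵥ (A *ᵥ v) := by
    rw [star_mulVec, hA.eq, dotProduct_mulVec]
  rw [hv, star_smul, smul_dotProduct, dotProduct_smul, smul_eq_mul, smul_eq_mul] at h
  exact mul_right_cancel₀ (fun h0 => hv0 (dotProduct_star_self_eq_zero.mp h0)) h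

/-- A commutator with a Hermitian matrix vanishes on each of its eigenspaces. -/
theorem IsHermitian.dotProduct_commutator_mulVec {A : Matrix n n ℂ} (hA : A.IsHermitian)
    (H : Matrix n n ℂ) {lam : ℂ} {v w : n → ℂ} (hv : A *ᵥ v = lam • v)
    (hw : A *ᵥ w = lam • w) : star v ⬝ᵥ ((H * A - A * H) *ᵥ w) = 0 := by
  by_cases hv0 : v = 0
  · simp [hv0]
  have hvA : star v ᵥ* A = lam • star v := by
    rw [← hA.star_eq_of_mulVec_eq_smul hv hv0, ← star_smul, ← hv, star_mulVec, hA.eq]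
  rw [sub_mulVec, dotProduct_sub, ← mulVec_mulVec, ← mulVec_mulVec, hw,
    dotProduct_mulVec (star v) A, hvA, mulVec_smul, dotProduct_smul, smul_dotProduct, sub_self]

/-- A Hermitian matrix that vanishes on every eigenspace of a Hermitian matrix `A` is, up to the
factor `I`, a commutator of `A` with a Hermitian matrix. -/
theorem IsHermitian.exists_commutator_eq [DecidableEq n] {A X : Matrix n n ℂ}
    (hA : A.IsHermitian) (hX : X.IsHermitian)
    (h : ∀ (lam : ℂ) (v w : n → ℂ), A *ᵥ v = lam • v → A *ᵥ w = lam • w →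
      star v ⬝ᵥ (X *ᵥ w) = 0) :
    ∃ H : Matrix n n ℂ, H.IsHermitian ∧ (-Complex.I) • (H * A - A * H) + X = 0 := by
  set U : Matrix n n ℂ := (hA.eigenvectorUnitary : Matrix n n ℂ)
  have hUU : Uᴴ * U = 1 := Unitary.coe_star_mul_self hA.eigenvectorUnitary
  have hUU' : U * Uᴴ = 1 := Unitary.coe_mul_star_self hA.eigenvectorUnitary
  set p : n → ℂ := fun a => (hA.eigenvalues a : ℂ)
  have hps (a : n) : star (p a) = p a := Complex.conj_ofReal _
  have hAU : A = U * diagonal p * Uᴴ := hA.spectral_theorem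
  set Y : Matrix n n ℂ := Uᴴ * X * U with hYdef
  have hY : Y.IsHermitian := isHermitian_conjTranspose_mul_mul U hX
  have hXU : X = U * Y * Uᴴ := by
    rw [hYdef, show U * (Uᴴ * X * U) * Uᴴ = (U * Uᴴ) * X * (U * Uᴴ) by
      simp only [Matrix.mul_assoc], hUU', Matrix.one_mul, Matrix.mul_one]
  have hcol (a : n) : A *ᵥ U.col a = p a • U.col a := by
    have hmul : A * U = U * diagonal p := by
      rw [hAU, Matrix.mul_assoc, hUU, Matrix.mul_one]
    ext i
    have := congrFun (congrFun hmul i) a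
    rw [mul_diagonal, mul_apply] at this
    simpa [mulVec, dotProduct, mul_comm] using this
  have hY0 (a b : n) (hab : p a = p b) : Y a b = 0 := by
    rw [← h (p a) (U.col a) (U.col b) (hcol a) (hab ▸ hcol b), hYdef, Matrix.mul_assoc, mul_apply]
    rfl
  set K : Matrix n n ℂ := of fun a b => -Complex.I * Y a b / (p b - p a) with hKdef
  have hK : K.IsHermitian := by
    ext a b
    have hYab : star (Y b a) = Y a b := hY.apply a b
    simp only [conjTranspose_apply, hKdef, of_apply, star_div₀, star_mul', star_sub, star_neg,
      hps, hYab]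
    rw [← neg_sub (p b) (p a), div_neg, ← neg_div]
    simp
  have hcomm : (-Complex.I) • (K * diagonal p - diagonal p * K) + Y = 0 := by
    ext a b
    simp only [add_apply, smul_apply, sub_apply, mul_diagonal, diagonal_mul, smul_eq_mul,
      zero_apply]
    by_cases hab : p a = p b
    · simp [hY0 a b hab, hab, mul_comm]
    · have hne : p b - p a ≠ 0 := sub_ne_zero.mpr (Ne.symm hab)
      have hKab : K a b * (p b - p a) = -Complex.I * Y a b := div_mul_cancel₀ _ hne
      linear_combination (-Complex.I) * hKab + Y a b * Complex.I_mul_I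
  refine ⟨U * K * Uᴴ, isHermitian_mul_mul_conjTranspose U hK, ?_⟩
  have hl : U * K * Uᴴ * A = U * (K * diagonal p) * Uᴴ := by
    rw [hAU, show U * K * Uᴴ * (U * diagonal p * Uᴴ) = U * K * (Uᴴ * U) * diagonal p * Uᴴ by
      simp only [Matrix.mul_assoc], hUU, Matrix.mul_one, Matrix.mul_assoc U]
  have hr : A * (U * K * Uᴴ) = U * (diagonal p * K) * Uᴴ := by
    rw [hAU, show U * diagonal p * Uᴴ * (U * K * Uᴴ) = U * diagonal p * (Uᴴ * U) * K * Uᴴ by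
      simp only [Matrix.mul_assoc], hUU, Matrix.mul_one, Matrix.mul_assoc U]
  rw [hl, hr, hXU, ← Matrix.sub_mul, ← Matrix.mul_sub, ← Matrix.smul_mul, ← Matrix.mul_smul,
    ← Matrix.add_mul, ← Matrix.mul_add, hcomm, Matrix.mul_zero, Matrix.zero_mul]

/-- The Lindblad dissipator maps Hermitian matrices to Hermitian matrices. -/
theorem IsHermitian.dissipator {ι : Type*} [Fintype ι] {A : Matrix n n ℂ} (hA : A.IsHermitian)
    (L : ι → Matrix n n ℂ) :
    (∑ j, (L j * A * (L j)ᴴ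
      - (1/2 : ℂ) • ((L j)ᴴ * L j * A + A * ((L j)ᴴ * L j)))).IsHermitian := by
  rw [IsHermitian, conjTranspose_sum]
  refine Finset.sum_congr rfl fun j _ => ?_
  simp [conjTranspose_mul, hA.eq, Matrix.mul_assoc, add_comm]

end Matrix

theorem stmt_0 {d m : ℕ}
    (ρ : Matrix (Fin d) (Fin d) ℂ)
    (hHerm : ρ.IsHermitian) (hPSD : ρ.PosSemidef) (hTr : ρ.trace = 1)
    (L : Fin m → Matrix (Fin d) (Fin d) ℂ)
    (D : Matrix (Fin d) (Fin d) ℂ → Matrix (Fin d) (Fin d) ℂ)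
    (hD : ∀ M, D M = ∑ j, (L j * M * (L j)ᴴ
      - (1/2 : ℂ) • ((L j)ᴴ * L j * M + M * ((L j)ᴴ * L j))))
    (γ : ℝ) (hγ : 0 < γ) :
    (∃ H : Matrix (Fin d) (Fin d) ℂ, H.IsHermitian ∧
        (-Complex.I) • (H * ρ - ρ * H) + (γ : ℂ) • D ρ = 0) ↔
    (∀ (lam : ℂ) (v w : Fin d → ℂ), ρ *ᵥ v = lam • v → ρ *ᵥ w = lam • w →
        star v ⬝ᵥ (D ρ *ᵥ w) = 0) := by
  have hγ0 : (γ : ℂ) ≠ 0 := Complex.ofReal_ne_zero.mpr hγ.ne'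
  constructor
  · rintro ⟨H, -, hH⟩ lam v w hv hw
    have h := congrArg (fun M : Matrix (Fin d) (Fin d) ℂ => star v ⬝ᵥ (M *ᵥ w)) hH
    simp only [add_mulVec, smul_mulVec, dotProduct_add, dotProduct_smul, zero_mulVec,
      dotProduct_zero, hHerm.dotProduct_commutator_mulVec H hv hw, smul_zero, zero_add] at h
    exact (smul_eq_zero.mp h).resolve_left hγ0
  · intro h
    have hX : ((γ : ℂ) • D ρ).IsHermitian := by
      have hDρ : (D ρ).IsHermitian := hD ρ ▸ hHerm.dissipator L
      rw [IsHermitian, conjTranspose_smul, hDρ.eq, Complex.star_def, Complex.conj_ofReal]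
    refine hHerm.exists_commutator_eq hX fun lam v w hv hw => ?_
    rw [smul_mulVec, dotProduct_smul, h lam v w hv hw, smul_zero]
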